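/- Let (E_k)_{k≥0} be a family of real inner product spaces and let 0 < c₂ < 1. Suppose given g_k ∈ E_k with g_k ≠ 0 for all k, u_k ∈ E_{k+1}, and sequences defined recursively by η_0 = −g_0, τ_k = min{1, ‖η_k‖/‖u_k‖}·u_k, β_{k+1} = ‖g_{k+1}‖²/(⟨g_{k+1}, τ_k⟩ − ⟨g_k, η_k⟩), η_{k+1} = −g_{k+1} + β_{k+1}τ_k, with the curvature condition ⟨g_{k+1}, u_k⟩ ≥ c₂⟨g_k, η_k⟩ holding for all k. If moreover the Zoutendijk series converges, i.e. ∑_{k=0}^∞ ⟨g_k, η_k⟩² / ‖η_k‖² < ∞, then liminf_{k→∞} ‖g_k‖ = 0. -/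

import Mathlib

open RealInnerProductSpace

/-- A positive sequence with eventually bounded increments has nonsummable reciprocals. -/
theorem not_summable_inv_of_le_add {r : ℕ → ℝ} (hr : ∀ k, 0 < r k) {D : ℝ} (hD : 0 < D) {N : ℕ}
    (h : ∀ k, N ≤ k → r (k + 1) ≤ r k + D) : ¬ Summable fun k => (r k)⁻¹ := by
  intro hs
  have hC : 0 < r N + D := add_pos (hr N) hD
  have hbound : ∀ m : ℕ, r (m + N) ≤ (r N + D) * ((m : ℝ) + 1) := by
    intro m
    induction m with
    | zero => simpa using hD.le
    | succ m ih =>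
      have h1 := h (m + N) (Nat.le_add_left _ _)
      rw [Nat.add_right_comm]
      push_cast
      linarith [hr N]
  have hs' : Summable fun m : ℕ => (r N + D)⁻¹ * ((m : ℝ) + 1)⁻¹ := by
    refine Summable.of_nonneg_of_le (fun m => by positivity) (fun m => ?_)
      ((summable_nat_add_iff N).2 hs)
    rw [← mul_inv]
    exact inv_anti₀ (hr _) (hbound m)
  rw [summable_mul_left_iff (inv_ne_zero hC.ne')] at hs'
  refine Real.not_summable_natCast_inv ((summable_nat_add_iff 1).1 ?_)
  simpa using hs'

/-- A nonnegative real sequence that is frequently below every positive number has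
lower limit zero. -/
theorem liminf_eq_zero_of_frequently_lt {f : ℕ → ℝ} (h0 : ∀ k, 0 ≤ f k)
    (h : ∀ ε > 0, ∃ᶠ k in Filter.atTop, f k < ε) : Filter.liminf f Filter.atTop = 0 := by
  have hset : {a | ∀ᶠ k in Filter.atTop, a ≤ f k} = Set.Iic 0 := by
    ext a
    refine ⟨fun ha => ?_, fun ha => Filter.Eventually.of_forall fun k => le_trans ha (h0 k)⟩
    by_contra hpos
    obtain ⟨k, hk, hk'⟩ := ((h a (not_le.1 hpos)).and_eventually ha).exists
    exact absurd hk (not_lt.2 hk')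
  rw [Filter.liminf_eq, hset, csSup_Iic]

/-- Rescaling a vector `u` to length at most `b` gives a vector of norm at most `b`. -/
theorem norm_min_one_div_smul_le {F : Type*} [NormedAddCommGroup F] [NormedSpace ℝ F]
    (u : F) {b : ℝ} (hb : 0 ≤ b) : ‖min 1 (b / ‖u‖) • u‖ ≤ b := by
  have hs : 0 ≤ min 1 (b / ‖u‖) := le_min zero_le_one (by positivity)
  rw [norm_smul, Real.norm_of_nonneg hs]
  calc min 1 (b / ‖u‖) * ‖u‖ ≤ b / ‖u‖ * ‖u‖ := by gcongr; exact min_le_right _ _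
    _ ≤ b := by
      rcases eq_or_ne ‖u‖ 0 with h | h
      · simpa [h] using hb
      · exact (div_mul_cancel₀ b h).le

/-- The Dai–Yuan denominator is positive along a descent direction. -/
theorem scaled_curvature_denominator_pos {F : Type*} [NormedAddCommGroup F]
    [InnerProductSpace ℝ F] {c a b : ℝ} (hc0 : 0 < c) (hc1 : c < 1) (ha : a < 0) (hb : 0 ≤ b)
    {g u : F} (h : c * a ≤ ⟪g, u⟫) : 0 < ⟪g, min 1 (b / ‖u‖) • u⟫ - a := by
  have hs : 0 ≤ min 1 (b / ‖u‖) := le_min zero_le_one (by positivity)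
  have hs1 : min 1 (b / ‖u‖) ≤ 1 := min_le_left _ _
  rw [real_inner_smul_right]
  nlinarith [mul_le_mul_of_nonneg_left h hs, mul_neg_of_pos_of_neg hc0 ha]

/-- For the Dai–Yuan direction `-g + β • t`, the slope is `β` times the previous slope. -/
theorem inner_dai_yuan_direction {F : Type*} [NormedAddCommGroup F] [InnerProductSpace ℝ F]
    (g t : F) {a : ℝ} (hd : ⟪g, t⟫ - a ≠ 0) :
    ⟪g, -g + (‖g‖ ^ 2 / (⟪g, t⟫ - a)) • t⟫ = ‖g‖ ^ 2 / (⟪g, t⟫ - a) * a := by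
  rw [inner_add_right, inner_neg_right, real_inner_smul_right, real_inner_self_eq_norm_sq]
  field_simp
  ring

/-- Growth of `‖η‖² / ⟪g, η⟫²` under one step `-g + β • t` whose slope is `β * a`. -/
theorem norm_sq_div_inner_sq_le {F : Type*} [NormedAddCommGroup F] [InnerProductSpace ℝ F]
    {g t : F} {a b β : ℝ} (hg : g ≠ 0) (ha : a ≠ 0) (hβ : β ≠ 0) (ht : ‖t‖ ≤ b)
    (h : ⟪g, -g + β • t⟫ = β * a) :
    ‖-g + β • t‖ ^ 2 / (β * a) ^ 2 ≤ b ^ 2 / a ^ 2 + (‖g‖ ^ 2)⁻¹ := by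
  have hG : 0 < ‖g‖ ^ 2 := by positivity
  have hexp : ‖-g + β • t‖ ^ 2 = β ^ 2 * ‖t‖ ^ 2 - 2 * (β * a) - ‖g‖ ^ 2 := by
    have h1 := norm_add_sq_real (-g + β • t) g
    rw [real_inner_comm, h, neg_add_cancel_comm, norm_smul, mul_pow, Real.norm_eq_abs,
      sq_abs] at h1
    linarith
  have ht2 : ‖t‖ ^ 2 ≤ b ^ 2 := by gcongr
  have hsq : -2 * (β * a) - ‖g‖ ^ 2 ≤ (‖g‖ ^ 2)⁻¹ * (β * a) ^ 2 := by
    rw [inv_mul_eq_div, le_div_iff₀ hG]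
    nlinarith [sq_nonneg (β * a + ‖g‖ ^ 2)]
  rw [div_le_iff₀ (by positivity)]
  have hb : b ^ 2 / a ^ 2 * (β * a) ^ 2 = β ^ 2 * b ^ 2 := by field_simp
  rw [add_mul, hb, hexp]
  nlinarith [mul_le_mul_of_nonneg_left ht2 (sq_nonneg β)]

/-- Global convergence of the scaled Dai–Yuan-type Riemannian conjugate
gradient method: if the Zoutendijk series converges, then liminf ‖g_k‖ = 0. -/
theorem scaled_dai_yuan_global_convergence
    {E : ℕ → Type*} [∀ k, NormedAddCommGroup (E k)] [∀ k, InnerProductSpace ℝ (E k)]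
    (c₂ : ℝ) (hc₂0 : 0 < c₂) (hc₂1 : c₂ < 1)
    (g : ∀ k, E k) (hg : ∀ k, g k ≠ 0)
    (u : ∀ k, E (k + 1)) (η : ∀ k, E k) (τ : ∀ k, E (k + 1)) (β : ℕ → ℝ)
    (hη0 : η 0 = -g 0)
    (hτ : ∀ k, τ k = min 1 (‖η k‖ / ‖u k‖) • u k)
    (hβ : ∀ k, β (k + 1) = ‖g (k + 1)‖ ^ 2 / (⟪g (k + 1), τ k⟫ - ⟪g k, η k⟫))
    (hη : ∀ k, η (k + 1) = -g (k + 1) + β (k + 1) • τ k)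
    (hcurv : ∀ k, ⟪g (k + 1), u k⟫ ≥ c₂ * ⟪g k, η k⟫)
    (hsum : Summable (fun k => ⟪g k, η k⟫ ^ 2 / ‖η k‖ ^ 2)) :
    Filter.liminf (fun k => ‖g k‖) Filter.atTop = 0 := by
  have hden : ∀ k, ⟪g k, η k⟫ < 0 → 0 < ⟪g (k + 1), τ k⟫ - ⟪g k, η k⟫ := fun k hk => by
    rw [hτ k]
    exact scaled_curvature_denominator_pos hc₂0 hc₂1 hk (norm_nonneg _) (hcurv k)
  have hslope : ∀ k, ⟪g k, η k⟫ < 0 → ⟪g (k + 1), η (k + 1)⟫ = β (k + 1) * ⟪g k, η k⟫ :=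
    fun k hk => by
      rw [hη k, hβ k]
      exact inner_dai_yuan_direction _ _ (hden k hk).ne'
  have hβpos : ∀ k, ⟪g k, η k⟫ < 0 → 0 < β (k + 1) := fun k hk => by
    rw [hβ k]
    exact div_pos (pow_pos (norm_pos_iff.2 (hg _)) 2) (hden k hk)
  have hdesc : ∀ k, ⟪g k, η k⟫ < 0 := by
    intro k
    induction k with
    | zero =>
      rw [hη0, inner_neg_right, neg_lt_zero]
      exact real_inner_self_pos.2 (hg 0)
    | succ k ih =>
      rw [hslope k ih]
      exact mul_neg_of_pos_of_neg (hβpos k ih) ih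
  have hηpos : ∀ k, 0 < ‖η k‖ := fun k => norm_pos_iff.2 fun h0 => by
    have := hdesc k
    simp [h0] at this
  have hstep : ∀ k, ‖η (k + 1)‖ ^ 2 / ⟪g (k + 1), η (k + 1)⟫ ^ 2 ≤
      ‖η k‖ ^ 2 / ⟪g k, η k⟫ ^ 2 + (‖g (k + 1)‖ ^ 2)⁻¹ := fun k => by
    have h1 := hslope k (hdesc k)
    rw [h1, hη k]
    rw [hη k] at h1
    refine norm_sq_div_inner_sq_le (hg _) (hdesc k).ne (hβpos k (hdesc k)).ne' ?_ h1
    rw [hτ k]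
    exact norm_min_one_div_smul_le _ (norm_nonneg _)
  refine liminf_eq_zero_of_frequently_lt (fun k => norm_nonneg _) fun ε hε hev => ?_
  obtain ⟨N, hN⟩ := Filter.eventually_atTop.1 hev
  refine not_summable_inv_of_le_add (r := fun k => ‖η k‖ ^ 2 / ⟪g k, η k⟫ ^ 2)
    (fun k => div_pos (pow_pos (hηpos k) 2) (sq_pos_of_neg (hdesc k)))
    (D := (ε ^ 2)⁻¹) (by positivity) (N := N) (fun k hk => ?_) (by simpa only [inv_div] using hsum)
  refine (hstep k).trans ?_
  have hle : ε ≤ ‖g (k + 1)‖ := not_lt.1 (hN (k + 1) (by omega))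
  gcongr
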